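/- arXiv:1709.07778 — 5 statements merged into one kernel-verified Lean document; each statement's English description precedes it below -/
import Mathlib

section
/- For every real s > 1, the function G_s(c) = (1 − 1/c)·s − log c is strictly decreasing in c on (s, ∞), satisfies G_s(s) > 0, and tends to −∞ as c → ∞, so that G_s has a unique root c₀(s) in (s, ∞). Moreover, s² < c₀(s) < e^s for all s > 1, and c₀(s)/e^s → 1 as s → ∞. -/
open Filter Set

theorem strictAntiOn_one_sub_inv_mul_sub_log {s : ℝ} (hs : 0 < s) :
    StrictAntiOn (fun c : ℝ => (1 - 1 / c) * s - Real.log c) (Set.Ioi s) := by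
  intro a (ha : s < a) b (hb : s < b) hab
  have ha0 : 0 < a := hs.trans ha
  have hb0 : 0 < b := hs.trans hb
  have hlog : Real.log a - Real.log b ≤ a / b - 1 := by
    rw [← Real.log_div ha0.ne' hb0.ne']
    exact Real.log_le_sub_one_of_pos (div_pos ha0 hb0)
  have hdiff : (1 / a - 1 / b) * s < 1 - a / b := by
    have heq : 1 - a / b - (1 / a - 1 / b) * s = (b - a) * (a - s) / (a * b) := by
      field_simp
    have hpos : 0 < (b - a) * (a - s) / (a * b) :=
      div_pos (mul_pos (sub_pos.2 hab) (sub_pos.2 ha)) (mul_pos ha0 hb0)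
    linarith
  change (1 - 1 / b) * s - Real.log b < (1 - 1 / a) * s - Real.log a
  linarith

theorem tendsto_one_sub_inv_mul_sub_log_atBot (s : ℝ) :
    Tendsto (fun c : ℝ => (1 - 1 / c) * s - Real.log c) atTop atBot := by
  have h : Tendsto (fun c : ℝ => (1 - 1 / c) * s) atTop (nhds ((1 - 0) * s)) := by
    simp only [one_div]
    exact (tendsto_inv_atTop_zero.const_sub 1).mul_const s
  simpa only [sub_eq_add_neg, Function.comp_def] using
    h.add_atBot (tendsto_neg_atTop_atBot.comp Real.tendsto_log_atTop)

theorem two_mul_log_lt_sub_inv {s : ℝ} (hs : 1 < s) : 2 * Real.log s < s - s⁻¹ := by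
  have h := Real.self_lt_sinh_iff.2 (Real.log_pos hs)
  rw [Real.sinh_log (by linarith)] at h
  linarith

theorem exists_root_one_sub_inv_mul_sub_log {s : ℝ} (hs : 1 < s) :
    ∃ c : ℝ, s ^ 2 < c ∧ c < Real.exp s ∧ (1 - 1 / c) * s - Real.log c = 0 := by
  have hs0 : 0 < s := by linarith
  have hlog := two_mul_log_lt_sub_inv hs
  have hle : s ^ 2 ≤ Real.exp s := by
    rw [← Real.log_le_iff_le_exp (by positivity), Real.log_pow]
    push_cast
    linarith [inv_pos.2 hs0]
  have hcont : ContinuousOn (fun c : ℝ => (1 - 1 / c) * s - Real.log c)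
      (Set.Icc (s ^ 2) (Real.exp s)) := by
    have hne : ∀ c ∈ Set.Icc (s ^ 2) (Real.exp s), c ≠ 0 := fun c hc =>
      (lt_of_lt_of_le (by positivity) hc.1).ne'
    fun_prop (disch := assumption)
  have hleft : 0 < (1 - 1 / s ^ 2) * s - Real.log (s ^ 2) := by
    have heq : (1 - 1 / s ^ 2) * s = s - s⁻¹ := by
      field_simp
    rw [heq, Real.log_pow]
    push_cast
    linarith
  have hright : (1 - 1 / Real.exp s) * s - Real.log (Real.exp s) < 0 := by
    rw [Real.log_exp]
    have : 0 < 1 / Real.exp s * s := by positivity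
    linarith
  obtain ⟨c, hc, hroot⟩ := intermediate_value_Ioo' hle hcont ⟨hright, hleft⟩
  exact ⟨c, hc.1, hc.2, hroot⟩

/-- For every real `s > 1`, the function `G_s(c) = (1 - 1/c) * s - log c` is strictly
decreasing on `(s, ∞)`, positive at `c = s`, tends to `-∞` as `c → ∞`, and has a unique
root `c₀ s` in `(s, ∞)`.  Moreover `s ^ 2 < c₀ s < e ^ s` for all `s > 1`, and
`c₀ s / e ^ s → 1` as `s → ∞`. -/
theorem stmt0 :
    ∃ c₀ : ℝ → ℝ,
      (∀ s : ℝ, 1 < s →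
        StrictAntiOn (fun c : ℝ => (1 - 1 / c) * s - Real.log c) (Set.Ioi s) ∧
        0 < (1 - 1 / s) * s - Real.log s ∧
        Tendsto (fun c : ℝ => (1 - 1 / c) * s - Real.log c) atTop atBot ∧
        (c₀ s ∈ Set.Ioi s ∧ (1 - 1 / c₀ s) * s - Real.log (c₀ s) = 0 ∧
          ∀ c ∈ Set.Ioi s, (1 - 1 / c) * s - Real.log c = 0 → c = c₀ s) ∧
        s ^ 2 < c₀ s ∧ c₀ s < Real.exp s) ∧
      Tendsto (fun s : ℝ => c₀ s / Real.exp s) atTop (nhds 1) := by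
  choose! c₀ hsq hexp hroot using
    fun (s : ℝ) (hs : 1 < s) => exists_root_one_sub_inv_mul_sub_log hs
  refine ⟨c₀, fun s hs => ?_, ?_⟩
  · have hs0 : 0 < s := by linarith
    have hmem : c₀ s ∈ Set.Ioi s := lt_trans (by nlinarith) (hsq s hs)
    have hanti := strictAntiOn_one_sub_inv_mul_sub_log hs0
    refine ⟨hanti, ?_, tendsto_one_sub_inv_mul_sub_log_atBot s,
      ⟨hmem, hroot s hs, fun c hc h => hanti.injOn hc hmem (h.trans (hroot s hs).symm)⟩,
      hsq s hs, hexp s hs⟩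
    have hlog := Real.log_lt_sub_one_of_pos hs0 hs.ne'
    have heq : (1 - 1 / s) * s = s - 1 := by
      field_simp
    linarith
  · have hdiv : Tendsto (fun s : ℝ => s / c₀ s) atTop (nhds 0) := by
      refine squeeze_zero' ?_ ?_ tendsto_inv_atTop_zero
      · filter_upwards [eventually_gt_atTop 1] with s hs
        have := hsq s hs
        have : 0 < c₀ s := by nlinarith
        positivity
      · filter_upwards [eventually_gt_atTop 1] with s hs
        have h := hsq s hs
        have hc : 0 < c₀ s := by nlinarith
        rw [inv_eq_one_div, div_le_div_iff₀ hc (by linarith)]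
        nlinarith
    have hlim : Tendsto (fun s : ℝ => Real.exp (-(s / c₀ s))) atTop (nhds 1) := by
      simpa [Function.comp_def] using (Real.continuous_exp.tendsto _).comp hdiv.neg
    refine hlim.congr' ?_
    filter_upwards [eventually_gt_atTop 1] with s hs
    have h := hsq s hs
    have hc : 0 < c₀ s := by nlinarith
    have hlog : -(s / c₀ s) = Real.log (c₀ s) - s := by
      have heq : (1 - 1 / c₀ s) * s = s - s / c₀ s := by ring
      linarith [hroot s hs]
    rw [hlog, Real.exp_sub, Real.exp_log hc]
end

section
/- Let θ̂ : ℝ^{2p} → ℝ^p be a measurable estimator with E_θ‖θ̂(X) − θ1‖² < ∞ for all θ with θ1 − θ2 ∈ A, and set R̲ = inf{ E_θ‖θ̂(X) − θ1‖² / (p σ_Y²) : θ1 − θ2 ∈ A }. If R̲ > 0, then for every c with 1 < c < c₀(1 + R̲), where c₀(s) denotes the unique root in (s, ∞) of G_s(c) = (1 − 1/c)·s − log c, one has R_KL(θ, q_{θ̂,c}) < R_KL(θ, q_{θ̂,1}) for every θ with θ1 − θ2 ∈ A; in particular the plug-in predictive density q_{θ̂,1} is dominated under Kullback–Leibler risk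 by each such variance-expanded q_{θ̂,c}. -/
open MeasureTheory Real Set

noncomputable section

/-- Euclidean space `ℝ^p`. -/
abbrev Ep (p : ℕ) := EuclideanSpace ℝ (Fin p)

/-- Density of `N_p(0, v I_p)` evaluated at `u`. -/
def gdens (p : ℕ) (v : ℝ) (u : Ep p) : ℝ :=
  (2 * Real.pi * v) ^ (-(p : ℝ) / 2) * Real.exp (-‖u‖ ^ 2 / (2 * v))

/-- Joint density of `X = (X1, X2)` with `X1 ~ N_p(θ1, σ1² I)`, `X2 ~ N_p(θ2, σ2² I)`
independent. -/
def jointDens (p : ℕ) (σ12 σ22 : ℝ) (θ1 θ2 : Ep p) (x : Ep p × Ep p) : ℝ :=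
  gdens p σ12 (x.1 - θ1) * gdens p σ22 (x.2 - θ2)

/-- Kullback–Leibler risk of the predictive density estimator `qhat` of the
`N_p(θ1, σY² I_p)` density of `Y1`, based on `X = (X1, X2)`. -/
def klRisk (p : ℕ) (σ12 σ22 σY2 : ℝ) (θ1 θ2 : Ep p)
    (qhat : Ep p × Ep p → Ep p → ℝ) : ℝ :=
  ∫ x : Ep p × Ep p,
    (∫ y : Ep p, gdens p σY2 (y - θ1) *
      Real.log (gdens p σY2 (y - θ1) / qhat x y)) *
    jointDens p σ12 σ22 θ1 θ2 x

lemma gdens_eq (p : ℕ) (v : ℝ) (u : Ep p) :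
    gdens p v u = (2 * π * v) ^ (-(p : ℝ) / 2) * exp (-(1 / (2 * v)) * ‖u‖ ^ 2) := by
  rw [gdens]
  congr 2
  ring

lemma gdens_pos (p : ℕ) {v : ℝ} (hv : 0 < v) (u : Ep p) : 0 < gdens p v u := by
  unfold gdens
  positivity

lemma integral_gdens (p : ℕ) {v : ℝ} (hv : 0 < v) : ∫ u, gdens p v u = 1 := by
  simp_rw [gdens_eq]
  rw [integral_const_mul, GaussianFourier.integral_rexp_neg_mul_sq_norm (by positivity),
    finrank_euclideanSpace_fin, show π / (1 / (2 * v)) = 2 * π * v by field_simp,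
    ← rpow_add (by positivity), neg_div, neg_add_cancel, rpow_zero]

lemma integrable_gdens (p : ℕ) {v : ℝ} (hv : 0 < v) : Integrable (gdens p v) :=
  Integrable.of_integral_ne_zero (by simp [integral_gdens p hv])

lemma integrable_norm_sq_mul_exp {p : ℕ} (hp : 0 < p) {b : ℝ} (hb : 0 < b) :
    Integrable (fun u : Ep p => ‖u‖ ^ 2 * exp (-b * ‖u‖ ^ 2)) := by
  have : Nonempty (Fin p) := ⟨⟨0, hp⟩⟩
  rw [integrable_fun_norm_addHaar volume (f := fun r : ℝ => r ^ 2 * exp (-b * r ^ 2)),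
    finrank_euclideanSpace_fin]
  have h := integrableOn_rpow_mul_exp_neg_mul_sq hb (s := (p - 1 + 2 : ℕ))
    (by linarith [(p - 1 + 2 : ℕ).cast_nonneg (α := ℝ)])
  refine h.congr_fun (fun r _ => ?_) measurableSet_Ioi
  simp only [rpow_natCast, smul_eq_mul]
  ring

lemma integral_norm_sq_mul_exp {p : ℕ} (hp : 0 < p) {b : ℝ} (hb : 0 < b) :
    ∫ u : Ep p, ‖u‖ ^ 2 * exp (-b * ‖u‖ ^ 2) =
      p / (2 * b) * ∫ u : Ep p, exp (-b * ‖u‖ ^ 2) := by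
  have : Nonempty (Fin p) := ⟨⟨0, hp⟩⟩
  have hp' : (0 : ℝ) < p := by exact_mod_cast hp
  rw [integral_fun_norm_addHaar volume (fun r : ℝ => r ^ 2 * exp (-b * r ^ 2)),
    integral_fun_norm_addHaar volume (fun r : ℝ => exp (-b * r ^ 2)), finrank_euclideanSpace_fin]
  have h1 : ∫ r in Ioi (0 : ℝ), r ^ (p - 1) • (r ^ 2 * exp (-b * r ^ 2)) =
      ∫ r in Ioi (0 : ℝ), r ^ ((p : ℝ) + 1) * exp (-b * r ^ (2 : ℝ)) := by
    refine setIntegral_congr_fun measurableSet_Ioi fun r _ => ?_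
    obtain ⟨q, rfl⟩ := Nat.exists_eq_succ_of_ne_zero hp.ne'
    have : ((q.succ : ℕ) : ℝ) + 1 = ((q + 2 : ℕ) : ℝ) := by push_cast; ring
    simp only [this, rpow_natCast, rpow_two, smul_eq_mul, Nat.succ_sub_one]
    ring
  have h2 : ∫ r in Ioi (0 : ℝ), r ^ (p - 1) • exp (-b * r ^ 2) =
      ∫ r in Ioi (0 : ℝ), r ^ ((p : ℝ) - 1) * exp (-b * r ^ (2 : ℝ)) := by
    refine setIntegral_congr_fun measurableSet_Ioi fun r _ => ?_
    obtain ⟨q, rfl⟩ := Nat.exists_eq_succ_of_ne_zero hp.ne'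
    have : ((q.succ : ℕ) : ℝ) - 1 = (q : ℝ) := by push_cast; ring
    simp only [this, rpow_natCast, rpow_two, smul_eq_mul, Nat.succ_sub_one]
  rw [h1, h2, integral_rpow_mul_exp_neg_mul_rpow two_pos (by linarith) hb,
    integral_rpow_mul_exp_neg_mul_rpow two_pos (by linarith) hb,
    show ((p : ℝ) + 1 + 1) / 2 = p / 2 + 1 by ring, Gamma_add_one (by positivity),
    show -((p : ℝ) + 1 + 1) / 2 = -p / 2 - 1 by ring, rpow_sub_one hb.ne', sub_add_cancel]
  simp only [smul_eq_mul, nsmul_eq_mul]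
  field_simp

lemma integrable_norm_sq_mul_gdens {p : ℕ} (hp : 0 < p) {v : ℝ} (hv : 0 < v) :
    Integrable (fun u => ‖u‖ ^ 2 * gdens p v u) := by
  have h := (integrable_norm_sq_mul_exp hp (b := 1 / (2 * v)) (by positivity)).const_mul
    ((2 * π * v) ^ (-(p : ℝ) / 2))
  refine h.congr (.of_forall fun u => ?_)
  simp only [gdens_eq]
  ring

lemma integral_norm_sq_mul_gdens {p : ℕ} (hp : 0 < p) {v : ℝ} (hv : 0 < v) :
    ∫ u, ‖u‖ ^ 2 * gdens p v u = p * v := by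
  have h := integral_norm_sq_mul_exp hp (b := 1 / (2 * v)) (by positivity)
  have h1 := integral_gdens p hv
  simp_rw [gdens_eq] at h1 ⊢
  rw [integral_const_mul] at h1
  simp_rw [mul_left_comm (‖_‖ ^ 2)]
  rw [integral_const_mul, h, mul_left_comm, h1]
  field_simp

lemma integrable_inner_mul_gdens {p : ℕ} (hp : 0 < p) {v : ℝ} (hv : 0 < v) (a : Ep p) :
    Integrable (fun u => inner ℝ u a * gdens p v u) := by
  refine ((integrable_norm_sq_mul_gdens hp hv).add
    ((integrable_gdens p hv).const_mul (‖a‖ ^ 2))).mono' ?_ (.of_forall fun u => ?_)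
  · exact (by fun_prop : Continuous fun u : Ep p => inner ℝ u a).aestronglyMeasurable.mul
      (integrable_gdens p hv).aestronglyMeasurable
  · have h := abs_real_inner_le_norm u a
    have hg := gdens_pos p hv u
    rw [norm_mul, norm_eq_abs, norm_eq_abs, abs_of_pos hg, Pi.add_apply, ← add_mul]
    gcongr
    nlinarith [sq_nonneg (‖u‖ - ‖a‖), sq_nonneg ‖u‖, sq_nonneg ‖a‖]

lemma integral_inner_mul_gdens (p : ℕ) (v : ℝ) (a : Ep p) :
    ∫ u, inner ℝ u a * gdens p v u = 0 := by
  have h := integral_neg_eq_self (fun u : Ep p => inner ℝ u a * gdens p v u) volume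
  simp only [gdens, norm_neg, inner_neg_left, neg_mul, integral_neg] at h
  simp only [gdens]
  linarith

lemma log_gdens_div {p : ℕ} {v c : ℝ} (hv : 0 < v) (hc : 0 < c) (u w : Ep p) :
    log (gdens p v u / gdens p (c * v) w) =
      p / 2 * log c - ‖u‖ ^ 2 / (2 * v) + ‖w‖ ^ 2 / (2 * (c * v)) := by
  have hcv : 0 < c * v := by positivity
  rw [log_div (gdens_pos p hv u).ne' (gdens_pos p hcv w).ne', gdens, gdens,
    log_mul (by positivity) (by positivity), log_mul (by positivity) (by positivity),
    log_exp, log_exp, log_rpow (by positivity), log_rpow (by positivity),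
    show 2 * π * (c * v) = c * (2 * π * v) by ring, log_mul hc.ne' (by positivity)]
  ring

/-- Kullback–Leibler divergence between `N_p(θ, v I_p)` and `N_p(t, c v I_p)`. -/
lemma integral_gdens_mul_log {p : ℕ} (hp : 0 < p) {v c : ℝ} (hv : 0 < v) (hc : 0 < c)
    (θ t : Ep p) :
    ∫ y, gdens p v (y - θ) * log (gdens p v (y - θ) / gdens p (c * v) (y - t)) =
      p / 2 * (log c - 1 + 1 / c) + 1 / (2 * c * v) * ‖t - θ‖ ^ 2 := by
  have hpt : ∀ y : Ep p,
      gdens p v (y - θ) * log (gdens p v (y - θ) / gdens p (c * v) (y - t)) =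
      (fun u : Ep p => (p / 2 * log c + ‖t - θ‖ ^ 2 / (2 * (c * v))) * gdens p v u +
        (1 / (2 * (c * v)) - 1 / (2 * v)) * (‖u‖ ^ 2 * gdens p v u) -
        1 / (c * v) * (inner ℝ u (t - θ) * gdens p v u)) (y - θ) := by
    intro y
    rw [log_gdens_div hv hc, ← sub_sub_sub_cancel_right y t θ, norm_sub_sq_real (y - θ)]
    dsimp only
    field_simp
    ring
  simp_rw [hpt]
  rw [integral_sub_right_eq_self (fun u : Ep p =>
      (p / 2 * log c + ‖t - θ‖ ^ 2 / (2 * (c * v))) * gdens p v u +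
        (1 / (2 * (c * v)) - 1 / (2 * v)) * (‖u‖ ^ 2 * gdens p v u) -
        1 / (c * v) * (inner ℝ u (t - θ) * gdens p v u)),
    integral_sub (by exact (((integrable_gdens p hv).const_mul _).add
      ((integrable_norm_sq_mul_gdens hp hv).const_mul _)))
      ((integrable_inner_mul_gdens hp hv _).const_mul _),
    integral_add ((integrable_gdens p hv).const_mul _)
      ((integrable_norm_sq_mul_gdens hp hv).const_mul _),
    integral_const_mul, integral_const_mul, integral_const_mul, integral_gdens p hv,
    integral_norm_sq_mul_gdens hp hv, integral_inner_mul_gdens]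
  field_simp
  ring

lemma integrable_jointDens (p : ℕ) {s t : ℝ} (hs : 0 < s) (ht : 0 < t) (θ1 θ2 : Ep p) :
    Integrable (jointDens p s t θ1 θ2) :=
  ((integrable_gdens p hs).comp_sub_right θ1).mul_prod
    ((integrable_gdens p ht).comp_sub_right θ2)

lemma jointDens_nonneg (p : ℕ) {s t : ℝ} (hs : 0 < s) (ht : 0 < t) (θ1 θ2 : Ep p)
    (x : Ep p × Ep p) : 0 ≤ jointDens p s t θ1 θ2 x :=
  mul_nonneg (gdens_pos p hs _).le (gdens_pos p ht _).le

lemma integral_jointDens (p : ℕ) {s t : ℝ} (hs : 0 < s) (ht : 0 < t) (θ1 θ2 : Ep p) :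
    ∫ x, jointDens p s t θ1 θ2 x = 1 := by
  have h := integral_prod_mul (μ := (volume : Measure (Ep p))) (ν := (volume : Measure (Ep p)))
    (fun u => gdens p s (u - θ1)) (fun u => gdens p t (u - θ2))
  rw [integral_sub_right_eq_self (gdens p s), integral_sub_right_eq_self (gdens p t),
    integral_gdens p hs, integral_gdens p ht, one_mul] at h
  exact h

lemma klRisk_gdens {p : ℕ} (hp : 0 < p) {s t v c : ℝ} (hs : 0 < s) (ht : 0 < t) (hv : 0 < v)
    (hc : 0 < c) (θ1 θ2 : Ep p) (θhat : Ep p × Ep p → Ep p)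
    (hint : Integrable fun x => ‖θhat x - θ1‖ ^ 2 * jointDens p s t θ1 θ2 x) :
    klRisk p s t v θ1 θ2 (fun x y => gdens p (c * v) (y - θhat x)) =
      p / 2 * (log c - 1 + 1 / c) +
        1 / (2 * c * v) * ∫ x, ‖θhat x - θ1‖ ^ 2 * jointDens p s t θ1 θ2 x := by
  rw [klRisk]
  simp_rw [integral_gdens_mul_log hp hv hc, add_mul,
    mul_assoc (1 / (2 * c * v)) (‖_‖ ^ 2) (jointDens _ _ _ _ _ _)]
  rw [integral_add ((integrable_jointDens p hs ht θ1 θ2).const_mul _) (hint.const_mul _),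
    integral_const_mul, integral_const_mul, integral_jointDens p hs ht, mul_one]

lemma log_lt_of_lt_root {s c c₀ : ℝ} (hc : 1 < c) (hcc : c < c₀)
    (hroot : (1 - 1 / c₀) * s - log c₀ = 0) : log c < (1 - 1 / c) * s := by
  have hc0 : 0 < c := by linarith
  have hc00 : 0 < c₀ := by linarith
  have h1 : 1 / c₀ < 1 / c := one_div_lt_one_div_of_lt hc0 hcc
  have h2 : 1 / c < 1 := by rw [div_lt_one hc0]; exact hc
  have hu : 0 < 1 / c₀ := by positivity
  have hlt := h1.trans h2
  have h := strictConcaveOn_log_Ioi.2 (mem_Ioi.2 hu) (mem_Ioi.2 one_pos) hlt.ne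
    (show 0 < (1 - 1 / c) / (1 - 1 / c₀) from div_pos (by linarith) (by linarith))
    (show 0 < (1 / c - 1 / c₀) / (1 - 1 / c₀) from div_pos (by linarith) (by linarith))
    (by rw [← add_div, sub_add_sub_cancel, div_self (by linarith)])
  have hne : (1 - 1 / c₀) ≠ 0 := by linarith
  have he : (1 - 1 / c) / (1 - 1 / c₀) * (1 / c₀) + (1 / c - 1 / c₀) / (1 - 1 / c₀) * 1 =
      1 / c := by
    rw [div_mul_eq_mul_div, div_mul_eq_mul_div, ← add_div, div_eq_iff hne]
    ring
  have hl : (1 - 1 / c) / (1 - 1 / c₀) * log (1 / c₀) = -((1 - 1 / c) * s) := by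
    rw [one_div c₀, log_inv, ← one_div, ← sub_eq_zero.1 hroot, div_mul_eq_mul_div,
      div_eq_iff hne]
    ring
  simp only [smul_eq_mul, he, hl, log_one, mul_zero, add_zero] at h
  rw [one_div c, log_inv, ← one_div] at h
  linarith

/-- Variance expansion improves on a plug-in predictive density: if
`R̲ = inf { E_θ‖θ̂(X) - θ1‖² / (p σY²) : θ1 - θ2 ∈ A } > 0` and `c₀` is the root of
`G_{1+R̲}(c) = (1 - 1/c)(1+R̲) - log c` in `(1+R̲, ∞)`, then for every `1 < c < c₀`
the predictive density `N_p(θ̂(X), c σY² I)` strictly improves on the plug-in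
`N_p(θ̂(X), σY² I)` in Kullback–Leibler risk at every `θ` with `θ1 - θ2 ∈ A`. -/
theorem stmt1 (p : ℕ) (hp : 0 < p) (σ12 σ22 σY2 : ℝ)
    (hσ1 : 0 < σ12) (hσ2 : 0 < σ22) (hσY : 0 < σY2)
    (A : Set (Ep p)) (hA : MeasurableSet A)
    (θhat : Ep p × Ep p → Ep p) (hmeas : Measurable θhat)
    (hint : ∀ θ1 θ2 : Ep p, θ1 - θ2 ∈ A →
      Integrable (fun x : Ep p × Ep p =>
        ‖θhat x - θ1‖ ^ 2 * jointDens p σ12 σ22 θ1 θ2 x))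
    (Rlow : ℝ)
    (hRlow : Rlow = sInf {ρ : ℝ | ∃ θ1 θ2 : Ep p, θ1 - θ2 ∈ A ∧
      ρ = (∫ x : Ep p × Ep p, ‖θhat x - θ1‖ ^ 2 * jointDens p σ12 σ22 θ1 θ2 x) /
        ((p : ℝ) * σY2)})
    (hRpos : 0 < Rlow)
    (c₀ : ℝ) (hc₀mem : 1 + Rlow < c₀)
    (hc₀root : (1 - 1 / c₀) * (1 + Rlow) - Real.log c₀ = 0)
    (c : ℝ) (hc1 : 1 < c) (hcc : c < c₀) :
    ∀ θ1 θ2 : Ep p, θ1 - θ2 ∈ A →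
      klRisk p σ12 σ22 σY2 θ1 θ2 (fun x y => gdens p (c * σY2) (y - θhat x)) <
      klRisk p σ12 σ22 σY2 θ1 θ2 (fun x y => gdens p σY2 (y - θhat x)) := by
  intro θ1 θ2 hθ
  set r := (∫ x : Ep p × Ep p, ‖θhat x - θ1‖ ^ 2 * jointDens p σ12 σ22 θ1 θ2 x) /
    ((p : ℝ) * σY2) with hr
  have hp' : (0 : ℝ) < p := by exact_mod_cast hp
  have hc : 0 < c := by linarith
  have hle : Rlow ≤ r := by
    rw [hRlow]
    refine csInf_le ⟨0, ?_⟩ ⟨θ1, θ2, hθ, hr⟩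
    rintro ρ ⟨η1, η2, -, rfl⟩
    exact div_nonneg (integral_nonneg fun x =>
      mul_nonneg (sq_nonneg _) (jointDens_nonneg p hσ1 hσ2 η1 η2 x)) (by positivity)
  have hI : ∫ x : Ep p × Ep p, ‖θhat x - θ1‖ ^ 2 * jointDens p σ12 σ22 θ1 θ2 x =
      r * (p * σY2) := by
    rw [hr, div_mul_cancel₀ _ (by positivity)]
  have h1 := klRisk_gdens hp hσ1 hσ2 hσY one_pos θ1 θ2 θhat (hint θ1 θ2 hθ)
  rw [one_mul] at h1
  rw [klRisk_gdens hp hσ1 hσ2 hσY hc θ1 θ2 θhat (hint θ1 θ2 hθ), h1, hI, log_one]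
  have hlog := log_lt_of_lt_root hc1 hcc hc₀root
  have hcinv : 1 / c < 1 := by rw [div_lt_one hc]; exact hc1
  have hmono : (1 - 1 / c) * (1 + Rlow) ≤ (1 - 1 / c) * (1 + r) :=
    mul_le_mul_of_nonneg_left (by linarith) (by linarith)
  have e1 : 1 / (2 * c * σY2) * (r * (p * σY2)) = p / 2 * (1 / c * r) := by field_simp
  have e2 : 1 / (2 * 1 * σY2) * (r * (p * σY2)) = p / 2 * r := by field_simp
  rw [e1, e2, ← mul_add, ← mul_add]
  refine mul_lt_mul_of_pos_left ?_ (by positivity)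
  linarith

end
end

section
/- Let W ~ N(μ, σ²) be a real Gaussian random variable with μ ≥ 0 and σ > 0, and let ρ = μ/σ. Then the mean squared error of the restricted maximum likelihood estimator max(0, W) of μ satisfies E[(max(0, W) − μ)²] = σ²·( 1/2 + ρ²Φ(−ρ) + ∫₀^ρ t²φ(t) dt ). Moreover, as a function of μ ∈ [0, ∞) this mean squared error is strictly increasing, equals σ²/2 at μ = 0, is everywhere strictly less than σ², and tends to σ² as μ → ∞; hence its infimum over μ ≥ 0 is σ²/2 and its supremum is σ². -/
open MeasureTheory Real Set Filter

noncomputable section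

/-- Standard normal probability density function. -/
def stdPdf (z : ℝ) : ℝ := (Real.sqrt (2 * Real.pi))⁻¹ * Real.exp (-z ^ 2 / 2)

/-- Standard normal cumulative distribution function. -/
def stdCdf (x : ℝ) : ℝ := ∫ t in Set.Iic x, stdPdf t

lemma stdPdf_pos (t : ℝ) : 0 < stdPdf t := by
  unfold stdPdf
  positivity

lemma continuous_stdPdf : Continuous stdPdf := by
  unfold stdPdf
  fun_prop

lemma stdPdf_neg (t : ℝ) : stdPdf (-t) = stdPdf t := by
  simp [stdPdf]

lemma stdPdf_eq_gaussianPDFReal (t : ℝ) :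
    stdPdf t = ProbabilityTheory.gaussianPDFReal 0 1 t := by
  simp [stdPdf, ProbabilityTheory.gaussianPDFReal]

lemma integral_sq_mul_stdPdf : ∫ t : ℝ, t ^ 2 * stdPdf t = 1 := by
  have h := ProbabilityTheory.variance_of_integral_eq_zero
    (μ := ProbabilityTheory.gaussianReal 0 1) (X := fun x : ℝ ↦ x)
    aemeasurable_id ProbabilityTheory.integral_id_gaussianReal
  rw [ProbabilityTheory.variance_fun_id_gaussianReal,
    ProbabilityTheory.integral_gaussianReal_eq_integral_smul one_ne_zero] at h
  simpa [stdPdf_eq_gaussianPDFReal, mul_comm] using h.symm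

lemma integrable_sq_mul_stdPdf : Integrable (fun t : ℝ ↦ t ^ 2 * stdPdf t) :=
  .of_integral_ne_zero (by rw [integral_sq_mul_stdPdf]; exact one_ne_zero)

lemma integral_Ioi_sq_mul_stdPdf : ∫ t in Ioi (0 : ℝ), t ^ 2 * stdPdf t = 1 / 2 := by
  have h := integral_comp_abs (f := fun t : ℝ ↦ t ^ 2 * stdPdf t)
  have habs (t : ℝ) : |t| ^ 2 * stdPdf |t| = t ^ 2 * stdPdf t := by
    simp [stdPdf, sq_abs]
  simp only [habs, integral_sq_mul_stdPdf] at h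
  linarith

lemma sq_max_neg_mono (t : ℝ) {a b : ℝ} (ha : 0 ≤ a) (hab : a ≤ b) :
    max (-a) t ^ 2 ≤ max (-b) t ^ 2 := by
  rcases le_total (-a) t with h | h
  · rw [max_eq_right h, max_eq_right (by linarith)]
  · have hb : max (-b) t ≤ -a := max_le (by linarith) h
    rw [max_eq_left h]
    nlinarith

lemma sq_max_neg_le_sq (t : ℝ) {a : ℝ} (ha : 0 ≤ a) : max (-a) t ^ 2 ≤ t ^ 2 := by
  rcases le_total (-a) t with h | h
  · rw [max_eq_right h]
  · rw [max_eq_left h]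
    nlinarith

/-- The integral `E[max(-a, Z)²]` for a standard normal variable `Z`: the mean squared error of
the restricted estimator in units of the variance. -/
def normalizedMSE (a : ℝ) : ℝ := ∫ t : ℝ, max (-a) t ^ 2 * stdPdf t

lemma continuous_sq_max_mul_stdPdf (a : ℝ) :
    Continuous (fun t : ℝ ↦ max (-a) t ^ 2 * stdPdf t) := by
  have := continuous_stdPdf
  fun_prop

lemma norm_sq_max_mul_stdPdf_le (t : ℝ) {a : ℝ} (ha : 0 ≤ a) :
    ‖max (-a) t ^ 2 * stdPdf t‖ ≤ t ^ 2 * stdPdf t := by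
  have hp := (stdPdf_pos t).le
  rw [Real.norm_of_nonneg (by positivity)]
  exact mul_le_mul_of_nonneg_right (sq_max_neg_le_sq t ha) hp

lemma integrable_sq_max_mul_stdPdf {a : ℝ} (ha : 0 ≤ a) :
    Integrable (fun t : ℝ ↦ max (-a) t ^ 2 * stdPdf t) :=
  integrable_sq_mul_stdPdf.mono' (continuous_sq_max_mul_stdPdf a).aestronglyMeasurable
    (.of_forall fun t ↦ norm_sq_max_mul_stdPdf_le t ha)

lemma strictMonoOn_normalizedMSE : StrictMonoOn normalizedMSE (Ici 0) := by
  intro a ha b hb hab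
  rw [mem_Ici] at ha hb
  rw [← sub_pos, normalizedMSE, normalizedMSE,
    ← integral_sub (integrable_sq_max_mul_stdPdf hb) (integrable_sq_max_mul_stdPdf ha)]
  refine integral_pos_of_integrable_nonneg_nonzero (x := -b)
    ((continuous_sq_max_mul_stdPdf b).sub (continuous_sq_max_mul_stdPdf a))
    ((integrable_sq_max_mul_stdPdf hb).sub (integrable_sq_max_mul_stdPdf ha)) (fun t ↦ ?_) ?_
  · exact sub_nonneg.2
      (mul_le_mul_of_nonneg_right (sq_max_neg_mono t ha hab.le) (stdPdf_pos t).le)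
  · rw [max_self, max_eq_left (by linarith), ← sub_mul]
    exact mul_ne_zero (by nlinarith) (stdPdf_pos _).ne'

lemma tendsto_normalizedMSE : Tendsto normalizedMSE atTop (nhds 1) := by
  rw [← integral_sq_mul_stdPdf]
  refine tendsto_integral_filter_of_dominated_convergence (fun t : ℝ ↦ t ^ 2 * stdPdf t)
    (.of_forall fun a ↦ (continuous_sq_max_mul_stdPdf a).aestronglyMeasurable) ?_
    integrable_sq_mul_stdPdf (.of_forall fun t ↦ ?_)
  · filter_upwards [eventually_ge_atTop 0] with a ha
    exact .of_forall fun t ↦ norm_sq_max_mul_stdPdf_le t ha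
  · refine tendsto_const_nhds.congr' ?_
    filter_upwards [eventually_ge_atTop (-t)] with a ha
    rw [max_eq_right (by linarith)]

lemma normalizedMSE_eq {a : ℝ} (ha : 0 ≤ a) :
    normalizedMSE a = 1 / 2 + a ^ 2 * stdCdf (-a) + ∫ t in (0 : ℝ)..a, t ^ 2 * stdPdf t := by
  have hleft : ∫ t in Iic (-a), max (-a) t ^ 2 * stdPdf t = a ^ 2 * stdCdf (-a) := by
    rw [stdCdf, ← integral_const_mul]
    refine setIntegral_congr_fun measurableSet_Iic fun t ht ↦ ?_
    simp only [max_eq_left (mem_Iic.1 ht), neg_sq]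
  have hright : ∫ t in Ioi (-a), max (-a) t ^ 2 * stdPdf t
      = ∫ t in Ioi (-a), t ^ 2 * stdPdf t := by
    refine setIntegral_congr_fun measurableSet_Ioi fun t ht ↦ ?_
    simp only [max_eq_right (mem_Ioi.1 ht).le]
  have hneg : ∫ t in (-a)..0, t ^ 2 * stdPdf t = ∫ t in (0 : ℝ)..a, t ^ 2 * stdPdf t := by
    have h := intervalIntegral.integral_comp_neg (a := 0) (b := a)
      (fun t : ℝ ↦ t ^ 2 * stdPdf t)
    simpa [stdPdf_neg] using h.symm
  rw [normalizedMSE, ← integral_add_compl measurableSet_Iic (integrable_sq_max_mul_stdPdf ha),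
    compl_Iic, hleft, hright, ← intervalIntegral.integral_interval_add_Ioi (b := 0)
      integrable_sq_mul_stdPdf.integrableOn integrable_sq_mul_stdPdf.integrableOn,
    hneg, integral_Ioi_sq_mul_stdPdf]
  ring

lemma integral_sq_max_zero_sub_mul_stdPdf {σ : ℝ} (hσ : 0 < σ) (μ : ℝ) :
    ∫ w : ℝ, (max 0 w - μ) ^ 2 * (σ⁻¹ * stdPdf ((w - μ) / σ))
      = σ ^ 2 * normalizedMSE (μ / σ) := by
  have h (w : ℝ) : (max 0 w - μ) ^ 2 * (σ⁻¹ * stdPdf ((w - μ) / σ))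
      = σ * (max (-(μ / σ)) ((w - μ) / σ) ^ 2 * stdPdf ((w - μ) / σ)) := by
    have hmax : max 0 w - μ = σ * max (-(μ / σ)) ((w - μ) / σ) := by
      rw [mul_max_of_nonneg _ _ hσ.le, ← max_sub_sub_right]
      congr 1 <;> field_simp
      ring
    rw [hmax]
    field_simp
  simp only [h]
  rw [integral_const_mul,
    integral_sub_right_eq_self
      (fun w : ℝ ↦ max (-(μ / σ)) (w / σ) ^ 2 * stdPdf (w / σ)) μ,
    Measure.integral_comp_div (fun t : ℝ ↦ max (-(μ / σ)) t ^ 2 * stdPdf t) σ,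
    abs_of_pos hσ, normalizedMSE, smul_eq_mul]
  ring

/-- The mean squared error `M μ = E[(max(0,W) - μ)²]` for `W ~ N(μ, σ²)`, `μ ≥ 0`:
closed form, strict monotonicity on `[0,∞)`, value `σ²/2` at `0`, strict bound `σ²`,
limit `σ²` at infinity, and the resulting infimum `σ²/2` and supremum `σ²`. -/
theorem stmt6 (σ : ℝ) (hσ : 0 < σ) (M : ℝ → ℝ)
    (hM : ∀ μ : ℝ, M μ =
      ∫ w : ℝ, (max 0 w - μ) ^ 2 * (σ⁻¹ * stdPdf ((w - μ) / σ))) :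
    (∀ μ : ℝ, 0 ≤ μ →
      M μ = σ ^ 2 * (1 / 2 + (μ / σ) ^ 2 * stdCdf (-(μ / σ)) +
        ∫ t in (0 : ℝ)..(μ / σ), t ^ 2 * stdPdf t)) ∧
    StrictMonoOn M (Set.Ici 0) ∧
    M 0 = σ ^ 2 / 2 ∧
    (∀ μ : ℝ, 0 ≤ μ → M μ < σ ^ 2) ∧
    Tendsto M atTop (nhds (σ ^ 2)) ∧
    sInf (M '' Set.Ici 0) = σ ^ 2 / 2 ∧
    sSup (M '' Set.Ici 0) = σ ^ 2 := by
  have hMn (μ : ℝ) : M μ = σ ^ 2 * normalizedMSE (μ / σ) := by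
    rw [hM, integral_sq_max_zero_sub_mul_stdPdf hσ]
  have hmono : StrictMonoOn M (Ici 0) := by
    intro a ha b hb hab
    rw [hMn, hMn]
    refine mul_lt_mul_of_pos_left (strictMonoOn_normalizedMSE ?_ ?_ ?_) (by positivity)
    · exact div_nonneg ha hσ.le
    · exact div_nonneg hb hσ.le
    · exact div_lt_div_of_pos_right hab hσ
  have hzero : M 0 = σ ^ 2 / 2 := by
    rw [hMn, zero_div, normalizedMSE_eq le_rfl]
    simp
    ring
  have hlim : Tendsto M atTop (nhds (σ ^ 2)) := by
    rw [funext hMn]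
    simpa using (tendsto_normalizedMSE.comp (tendsto_id.atTop_div_const hσ)).const_mul (σ ^ 2)
  have hlt (μ : ℝ) (hμ : 0 ≤ μ) : M μ < σ ^ 2 := by
    have hμ' : (0 : ℝ) ≤ μ + 1 := by linarith
    refine (hmono hμ hμ' (lt_add_one μ)).trans_le (ge_of_tendsto hlim ?_)
    filter_upwards [eventually_ge_atTop (μ + 1)] with x hx
    exact hmono.monotoneOn hμ' (hμ'.trans hx) hx
  refine ⟨fun μ hμ ↦ ?_, hmono, hzero, hlt, hlim, ?_, ?_⟩
  · rw [hMn, normalizedMSE_eq (div_nonneg hμ hσ.le)]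
  · refine IsLeast.csInf_eq ⟨⟨0, self_mem_Ici, hzero⟩, ?_⟩
    rintro _ ⟨μ, hμ, rfl⟩
    rw [← hzero]
    exact hmono.monotoneOn self_mem_Ici hμ hμ
  · refine IsLUB.csSup_eq ⟨?_, fun c hc ↦ ?_⟩ (nonempty_Ici.image M)
    · rintro _ ⟨μ, hμ, rfl⟩
      exact (hlt μ hμ).le
    · refine le_of_tendsto hlim ?_
      filter_upwards [eventually_ge_atTop 0] with μ hμ
      exact hc (mem_image_of_mem M hμ)

end
end

section
/- Let |α| < 1, σ² > 0, c > 0, m, θ ∈ ℝ^p, and let q̂ be the density of N_p(m, cσ² I_p) and q the density of N_p(θ, σ² I_p). Then ∫_{ℝ^p} q̂(y)^{(1+α)/2} q(y)^{(1−α)/2} dy = K(α, c, p) · exp( −‖m − θ‖² (1−α²) / (4σ²[(1+α) + c(1−α)]) ), where K(α, c, p) = 2^{p/2} c^{p(1−α)/4} / ((1+α) + c(1−α))^{p/2}. Consequently, in the model below, for measurable estimators θ̂_A, θ̂_B : ℝ^{2p} → ℝ^p, at every θ one has R_α(θ, q_{θ̂_A,c}) ≤ R_α(θ, q_{θ̂_B,c})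 if and only if E_θ[exp(−‖θ̂_A(X) − θ1‖²/(2γ))] ≥ E_θ[exp(−‖θ̂_B(X) − θ1‖²/(2γ))], where γ = 2σ_Y²( c/(1+α) + 1/(1−α) ); i.e., the α-divergence risk of q_{θ̂,c} is dual to the risk of θ̂ under the reflected normal loss 1 − exp(−‖θ̂ − θ1‖²/(2γ)). -/
open MeasureTheory Real Set

noncomputable section

/-- α-divergence risk (|α| < 1) of a predictive density estimator. -/
def aRisk (p : ℕ) (α σ12 σ22 σY2 : ℝ) (θ1 θ2 : Ep p)
    (qhat : Ep p × Ep p → Ep p → ℝ) : ℝ :=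
  ∫ x : Ep p × Ep p,
    (4 / (1 - α ^ 2)) *
      (1 - ∫ y : Ep p, (qhat x y) ^ ((1 + α) / 2) *
        (gdens p σY2 (y - θ1)) ^ ((1 - α) / 2)) *
    jointDens p σ12 σ22 θ1 θ2 x

lemma weighted_sq_dist_add {E : Type*} [NormedAddCommGroup E] [InnerProductSpace ℝ E]
    {a b : ℝ} (hab : a + b ≠ 0) (m θ y : E) :
    a * ‖y - m‖ ^ 2 + b * ‖y - θ‖ ^ 2 =
      (a + b) * ‖y - ((a / (a + b)) • m + (b / (a + b)) • θ)‖ ^ 2 +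
        a * b / (a + b) * ‖m - θ‖ ^ 2 := by
  set z := y - ((a / (a + b)) • m + (b / (a + b)) • θ) with hz
  have hs : a / (a + b) + b / (a + b) = 1 := by rw [← add_div, div_self hab]
  have h1 : y - m = z - (b / (a + b)) • (m - θ) := by
    have : a / (a + b) = 1 - b / (a + b) := by linarith
    rw [hz, this]
    module
  have h2 : y - θ = z + (a / (a + b)) • (m - θ) := by
    have : b / (a + b) = 1 - a / (a + b) := by linarith
    rw [hz, this]
    module
  rw [h1, h2, norm_sub_sq_real, norm_add_sq_real, inner_smul_right, inner_smul_right,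
    norm_smul, norm_smul, mul_pow, mul_pow, Real.norm_eq_abs, Real.norm_eq_abs, sq_abs, sq_abs]
  field_simp
  ring

lemma integral_exp_neg_weighted_sq_dist (p : ℕ) {a b : ℝ} (hab : 0 < a + b) (m θ : Ep p) :
    ∫ y : Ep p, Real.exp (-(a * ‖y - m‖ ^ 2 + b * ‖y - θ‖ ^ 2)) =
      (Real.pi / (a + b)) ^ ((p : ℝ) / 2) * Real.exp (-(a * b / (a + b) * ‖m - θ‖ ^ 2)) := by
  have h : ∀ y : Ep p, Real.exp (-(a * ‖y - m‖ ^ 2 + b * ‖y - θ‖ ^ 2)) =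
      Real.exp (-(a + b) * ‖y - ((a / (a + b)) • m + (b / (a + b)) • θ)‖ ^ 2) *
        Real.exp (-(a * b / (a + b) * ‖m - θ‖ ^ 2)) := by
    intro y
    rw [weighted_sq_dist_add hab.ne', ← Real.exp_add]
    congr 1
    ring
  simp_rw [h]
  rw [integral_mul_const,
    integral_sub_right_eq_self (fun y : Ep p => Real.exp (-(a + b) * ‖y‖ ^ 2)),
    GaussianFourier.integral_rexp_neg_mul_sq_norm hab, finrank_euclideanSpace_fin]

lemma gdens_rpow (p : ℕ) {v : ℝ} (hv : 0 < v) (r : ℝ) (u : Ep p) :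
    gdens p v u ^ r =
      (2 * Real.pi * v) ^ (-(p : ℝ) / 2 * r) * Real.exp (-(r / (2 * v) * ‖u‖ ^ 2)) := by
  have := Real.pi_pos
  rw [gdens, Real.mul_rpow (by positivity) (by positivity), ← Real.rpow_mul (by positivity),
    ← Real.exp_mul]
  congr 2
  ring

lemma integral_gdens_rpow_mul_gdens_rpow (p : ℕ) {α : ℝ} (hα : |α| < 1) {v : ℝ} (hv : 0 < v)
    {c : ℝ} (hc : 0 < c) (m θ : Ep p) :
    (∫ y : Ep p, (gdens p (c * v) (y - m)) ^ ((1 + α) / 2) *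
        (gdens p v (y - θ)) ^ ((1 - α) / 2)) =
      (2 : ℝ) ^ ((p : ℝ) / 2) * c ^ ((p : ℝ) * (1 - α) / 4) /
          ((1 + α) + c * (1 - α)) ^ ((p : ℝ) / 2) *
        Real.exp (-‖m - θ‖ ^ 2 * (1 - α ^ 2) /
          (4 * v * ((1 + α) + c * (1 - α)))) := by
  obtain ⟨h1, h2⟩ := abs_lt.mp hα
  have hα1 : 0 < 1 + α := by linarith
  have hα2 : 0 < 1 - α := by linarith
  have hπ := Real.pi_pos
  set D := (1 + α) + c * (1 - α) with hD
  have hDpos : 0 < D := by positivity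
  set a := (1 + α) / 2 / (2 * (c * v)) with ha
  set b := (1 - α) / 2 / (2 * v) with hb
  have hsum : a + b = D / (4 * c * v) := by
    rw [ha, hb, hD]
    field_simp
    ring
  have hab : 0 < a + b := by rw [hsum]; positivity
  have h : ∀ y : Ep p, (gdens p (c * v) (y - m)) ^ ((1 + α) / 2) *
        (gdens p v (y - θ)) ^ ((1 - α) / 2) =
      (2 * Real.pi * (c * v)) ^ (-(p : ℝ) / 2 * ((1 + α) / 2)) *
        (2 * Real.pi * v) ^ (-(p : ℝ) / 2 * ((1 - α) / 2)) *
        Real.exp (-(a * ‖y - m‖ ^ 2 + b * ‖y - θ‖ ^ 2)) := by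
    intro y
    rw [gdens_rpow p (mul_pos hc hv), gdens_rpow p hv, neg_add, Real.exp_add]
    ring
  simp_rw [h]
  rw [integral_const_mul, integral_exp_neg_weighted_sq_dist p hab, ← mul_assoc]
  congr 1
  · have e1 : 2 * Real.pi * (c * v) = c * (2 * Real.pi * v) := by ring
    have e2 : Real.pi / (a + b) = 2 * (2 * Real.pi * v) * c / D := by
      rw [hsum]
      field_simp
      ring
    have hw : 0 < 2 * Real.pi * v := by positivity
    rw [e1, e2]
    generalize 2 * Real.pi * v = w at hw
    rw [Real.mul_rpow hc.le hw.le, Real.div_rpow (by positivity) hDpos.le,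
      Real.mul_rpow (by positivity) hc.le, Real.mul_rpow zero_le_two hw.le]
    have hwp : w ^ (-(p : ℝ) / 2 * ((1 + α) / 2)) * w ^ (-(p : ℝ) / 2 * ((1 - α) / 2)) *
        w ^ ((p : ℝ) / 2) = 1 := by
      rw [← Real.rpow_add hw, ← Real.rpow_add hw]
      ring_nf
      exact Real.rpow_zero w
    have hcp : c ^ (-(p : ℝ) / 2 * ((1 + α) / 2)) * c ^ ((p : ℝ) / 2) =
        c ^ ((p : ℝ) * (1 - α) / 4) := by
      rw [← Real.rpow_add hc]
      congr 1
      ring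
    rw [← hcp]
    linear_combination (2 : ℝ) ^ ((p : ℝ) / 2) * (c ^ (-(p : ℝ) / 2 * ((1 + α) / 2)) *
      c ^ ((p : ℝ) / 2)) / D ^ ((p : ℝ) / 2) * hwp
  · congr 1
    rw [hsum, ha, hb]
    field_simp
    ring

lemma integrable_jointDens_s7 (p : ℕ) {σ12 σ22 : ℝ} (h1 : 0 < σ12) (h2 : 0 < σ22) (θ1 θ2 : Ep p) :
    Integrable (jointDens p σ12 σ22 θ1 θ2) :=
  ((integrable_gdens p h1).comp_sub_right θ1).mul_prod ((integrable_gdens p h2).comp_sub_right θ2)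

lemma integrable_exp_neg_sq_dist_mul_jointDens (p : ℕ) {σ12 σ22 : ℝ} (h1 : 0 < σ12)
    (h2 : 0 < σ22) {g : ℝ} (hg : 0 ≤ g) {θhat : Ep p × Ep p → Ep p} (hm : Measurable θhat)
    (θ1 θ2 : Ep p) :
    Integrable fun x => Real.exp (-‖θhat x - θ1‖ ^ 2 / g) * jointDens p σ12 σ22 θ1 θ2 x := by
  refine (integrable_jointDens_s7 p h1 h2 θ1 θ2).bdd_mul (c := 1) ?_ (.of_forall fun x => ?_)
  · exact Measurable.aestronglyMeasurable (by fun_prop)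
  · rw [Real.norm_eq_abs, Real.abs_exp, Real.exp_le_one_iff]
    exact div_nonpos_of_nonpos_of_nonneg (neg_nonpos.mpr (sq_nonneg _)) hg

lemma aRisk_gdens_eq (p : ℕ) {α : ℝ} (hα : |α| < 1) {σ12 σ22 σY2 : ℝ} (h1 : 0 < σ12)
    (h2 : 0 < σ22) (hY : 0 < σY2) {c : ℝ} (hc : 0 < c) {θhat : Ep p × Ep p → Ep p}
    (hm : Measurable θhat) (θ1 θ2 : Ep p) :
    aRisk p α σ12 σ22 σY2 θ1 θ2 (fun x y => gdens p (c * σY2) (y - θhat x)) =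
      4 / (1 - α ^ 2) * ((∫ x, jointDens p σ12 σ22 θ1 θ2 x) -
        (2 : ℝ) ^ ((p : ℝ) / 2) * c ^ ((p : ℝ) * (1 - α) / 4) /
          ((1 + α) + c * (1 - α)) ^ ((p : ℝ) / 2) *
        ∫ x : Ep p × Ep p, Real.exp (-‖θhat x - θ1‖ ^ 2 /
          (2 * (2 * σY2 * (c / (1 + α) + 1 / (1 - α))))) * jointDens p σ12 σ22 θ1 θ2 x) := by
  obtain ⟨hl, hr⟩ := abs_lt.mp hα
  have hα1 : 0 < 1 + α := by linarith
  have hα2 : 0 < 1 - α := by linarith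
  have hexp : ∀ x, -‖θhat x - θ1‖ ^ 2 * (1 - α ^ 2) / (4 * σY2 * ((1 + α) + c * (1 - α))) =
      -‖θhat x - θ1‖ ^ 2 / (2 * (2 * σY2 * (c / (1 + α) + 1 / (1 - α)))) := by
    intro x
    have hg : 2 * (2 * σY2 * (c / (1 + α) + 1 / (1 - α))) =
        4 * σY2 * ((1 + α) + c * (1 - α)) / (1 - α ^ 2) := by
      rw [show 1 - α ^ 2 = (1 + α) * (1 - α) by ring]
      field_simp
      ring
    rw [hg, div_div_eq_mul_div]
  simp only [aRisk, integral_gdens_rpow_mul_gdens_rpow p hα hY hc, hexp]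
  rw [← integral_const_mul, ← integral_sub (integrable_jointDens_s7 p h1 h2 θ1 θ2)
    ((integrable_exp_neg_sq_dist_mul_jointDens p h1 h2 (by positivity) hm θ1 θ2).const_mul _),
    ← integral_const_mul]
  congr 1
  ext x
  ring

/-- The Gaussian Hellinger-type integral identity
`∫ q̂^{(1+α)/2} q^{(1-α)/2} = K(α,c,p) exp(-‖m-θ‖²(1-α²)/(4σ²[(1+α)+c(1-α)]))`
and the resulting duality between α-divergence risk of `q_{θ̂,c}` and the reflected
normal loss `1 - exp(-‖θ̂-θ1‖²/(2γ))` with `γ = 2σY²(c/(1+α) + 1/(1-α))`. -/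
theorem stmt7 (p : ℕ) (α : ℝ) (hα : |α| < 1) :
    (∀ v : ℝ, 0 < v → ∀ c : ℝ, 0 < c → ∀ m θ : Ep p,
      (∫ y : Ep p, (gdens p (c * v) (y - m)) ^ ((1 + α) / 2) *
        (gdens p v (y - θ)) ^ ((1 - α) / 2)) =
      (2 : ℝ) ^ ((p : ℝ) / 2) * c ^ ((p : ℝ) * (1 - α) / 4) /
          ((1 + α) + c * (1 - α)) ^ ((p : ℝ) / 2) *
        Real.exp (-‖m - θ‖ ^ 2 * (1 - α ^ 2) /
          (4 * v * ((1 + α) + c * (1 - α))))) ∧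
    (∀ σ12 σ22 σY2 : ℝ, 0 < σ12 → 0 < σ22 → 0 < σY2 → ∀ c : ℝ, 0 < c →
      ∀ θhatA θhatB : Ep p × Ep p → Ep p, Measurable θhatA → Measurable θhatB →
      ∀ θ1 θ2 : Ep p,
        (aRisk p α σ12 σ22 σY2 θ1 θ2
            (fun x y => gdens p (c * σY2) (y - θhatA x)) ≤
         aRisk p α σ12 σ22 σY2 θ1 θ2
            (fun x y => gdens p (c * σY2) (y - θhatB x)) ↔
         (∫ x : Ep p × Ep p,
            Real.exp (-‖θhatB x - θ1‖ ^ 2 /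
              (2 * (2 * σY2 * (c / (1 + α) + 1 / (1 - α))))) *
              jointDens p σ12 σ22 θ1 θ2 x) ≤
         (∫ x : Ep p × Ep p,
            Real.exp (-‖θhatA x - θ1‖ ^ 2 /
              (2 * (2 * σY2 * (c / (1 + α) + 1 / (1 - α))))) *
              jointDens p σ12 σ22 θ1 θ2 x))) := by
  refine ⟨fun v hv c hc m θ => integral_gdens_rpow_mul_gdens_rpow p hα hv hc m θ, ?_⟩
  intro σ12 σ22 σY2 h1 h2 hY c hc θhatA θhatB hA hB θ1 θ2
  obtain ⟨hl, hr⟩ := abs_lt.mp hα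
  have hα1 : 0 < 1 + α := by linarith
  have hα2 : 0 < 1 - α := by linarith
  have hk : 0 < 4 / (1 - α ^ 2) := by
    rw [show 1 - α ^ 2 = (1 + α) * (1 - α) by ring]
    positivity
  rw [aRisk_gdens_eq p hα h1 h2 hY hc hA, aRisk_gdens_eq p hα h1 h2 hY hc hB,
    mul_le_mul_iff_right₀ hk, sub_le_sub_iff_left, mul_le_mul_iff_right₀ (by positivity)]

end
end

section
/- Let n ≥ 1 be an integer and α0, α1 ∈ ℝ. Then ∫_ℝ φ(z) Φ(α0 + α1 z)^n dz = P( for all i ∈ {1, …, n}: U_i ≤ α0 + α1 U_0 ), where U_0, U_1, …, U_n are i.i.d. N(0,1); equivalently, this equals P( for all i: W_i ≤ α0/√(1+α1²) ), where W_i = (U_i − α1 U_0)/√(1+α1²) for i = 1, …, n are standard normal random variables with Cov(W_i, W_j) = α1²/(1+α1²) for i ≠ j. (This evaluates the normalization constant K_n(α0, α1) of the generalized Balakrishnan-type skew-normal density proportional to φ(t)Φ(α0 + α1 t)^n.) -/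
open MeasureTheory Real Set
open scoped BigOperators

noncomputable section

open ProbabilityTheory

/-- If each `f i` is a nonnegative integrable density, the product of the measures with densities
`f i` is the measure with density the product of the `f i`. -/
lemma pi_withDensity_ofReal {ι : Type*} [Fintype ι] {E : Type*} [MeasurableSpace E]
    (μ : ι → Measure E) [∀ i, SigmaFinite (μ i)] (f : ι → E → ℝ)
    (hf : ∀ i, Integrable (f i) (μ i)) (hf0 : ∀ i x, 0 ≤ f i x) :
    Measure.pi (fun i => (μ i).withDensity fun x => ENNReal.ofReal (f i x)) =
      (Measure.pi μ).withDensity fun u => ENNReal.ofReal (∏ i, f i (u i)) := by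
  refine Measure.pi_eq fun s hs => ?_
  rw [withDensity_apply _ (MeasurableSet.univ_pi hs), Measure.restrict_pi_pi,
    ← ofReal_integral_eq_lintegral_ofReal
      (Integrable.fintype_prod_dep fun i => (hf i).restrict)
      (ae_of_all _ fun u => Finset.prod_nonneg fun i _ => hf0 i _),
    integral_fintype_prod_eq_prod,
    ENNReal.ofReal_prod_of_nonneg fun i _ => integral_nonneg (hf0 i)]
  refine Finset.prod_congr rfl fun i _ => ?_
  rw [withDensity_apply _ (hs i),
    ofReal_integral_eq_lintegral_ofReal (hf i).restrict (ae_of_all _ (hf0 i))]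

/-- The law of a finite family of independent standard normal variables. -/
abbrev stdGaussianPi (ι : Type*) [Fintype ι] : Measure (ι → ℝ) :=
  Measure.pi fun _ => gaussianReal 0 1

lemma stdPdf_eq_gaussianPDFReal_s12 : stdPdf = gaussianPDFReal 0 1 := by
  ext x
  simp [stdPdf, gaussianPDFReal]

lemma stdPdf_nonneg (x : ℝ) : 0 ≤ stdPdf x := by
  rw [stdPdf_eq_gaussianPDFReal_s12]
  exact gaussianPDFReal_nonneg _ _ _

lemma integrable_stdPdf : Integrable stdPdf := by
  rw [stdPdf_eq_gaussianPDFReal_s12]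
  exact integrable_gaussianPDFReal _ _

lemma gaussianReal_eq_withDensity_stdPdf :
    gaussianReal 0 1 = volume.withDensity fun x => ENNReal.ofReal (stdPdf x) := by
  rw [gaussianReal_of_var_ne_zero _ one_ne_zero, stdPdf_eq_gaussianPDFReal_s12]
  rfl

lemma gaussianReal_real_Iic (x : ℝ) : (gaussianReal 0 1).real (Iic x) = stdCdf x := by
  rw [measureReal_def, gaussianReal_apply_eq_integral _ one_ne_zero,
    ← stdPdf_eq_gaussianPDFReal_s12, ENNReal.toReal_ofReal (integral_nonneg stdPdf_nonneg), stdCdf]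

lemma integral_mul_prod_stdPdf {ι : Type*} [Fintype ι] (f : (ι → ℝ) → ℝ) :
    ∫ u, f u * ∏ i, stdPdf (u i) = ∫ u, f u ∂stdGaussianPi ι := by
  have hm : Measurable stdPdf := by
    unfold stdPdf
    fun_prop
  have h : stdGaussianPi ι =
      volume.withDensity fun u : ι → ℝ => ENNReal.ofReal (∏ i, stdPdf (u i)) := by
    rw [stdGaussianPi, gaussianReal_eq_withDensity_stdPdf, volume_pi]
    exact pi_withDensity_ofReal _ _ (fun _ => integrable_stdPdf) fun _ => stdPdf_nonneg
  rw [h, integral_withDensity_eq_integral_toReal_smul (by fun_prop)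
    (ae_of_all _ fun _ => ENNReal.ofReal_lt_top)]
  refine integral_congr_ae (ae_of_all _ fun u => ?_)
  simp only [ENNReal.toReal_ofReal (Finset.prod_nonneg fun i _ => stdPdf_nonneg (u i)),
    smul_eq_mul, mul_comm]

lemma integral_indicator_mul_prod_stdPdf {ι : Type*} [Fintype ι] {s : Set (ι → ℝ)}
    (hs : MeasurableSet s) :
    ∫ u, s.indicator (fun _ => (1 : ℝ)) u * ∏ i, stdPdf (u i) = (stdGaussianPi ι).real s := by
  rw [integral_mul_prod_stdPdf, integral_indicator hs]
  simp

lemma stdGaussianPi_real_forall_succ_le (n : ℕ) {g : ℝ → ℝ} (hg : Measurable g) :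
    (stdGaussianPi (Fin (n + 1))).real {u | ∀ i : Fin n, u i.succ ≤ g (u 0)} =
      ∫ z, stdPdf z * stdCdf (g z) ^ n := by
  have hs : MeasurableSet {p : ℝ × (Fin n → ℝ) | ∀ i, p.2 i ≤ g p.1} := by
    rw [ofPred_forall]
    exact .iInter fun i => measurableSet_le (by fun_prop) (by fun_prop)
  have hmp := measurePreserving_piFinSuccAbove (fun _ : Fin (n + 1) => gaussianReal 0 1) 0
  have hpre : {u : Fin (n + 1) → ℝ | ∀ i : Fin n, u i.succ ≤ g (u 0)} =
      MeasurableEquiv.piFinSuccAbove (fun _ => ℝ) 0 ⁻¹' {p | ∀ i, p.2 i ≤ g p.1} := rfl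
  rw [hpre, measureReal_def, hmp.measure_preimage hs.nullMeasurableSet, Measure.prod_apply hs,
    ← integral_toReal (measurable_measure_prodMk_left hs).aemeasurable
      (ae_of_all _ fun _ => measure_lt_top _ _),
    integral_gaussianReal_eq_integral_smul one_ne_zero]
  refine integral_congr_ae (ae_of_all _ fun z => ?_)
  have hz : Prod.mk z ⁻¹' {p : ℝ × (Fin n → ℝ) | ∀ i, p.2 i ≤ g p.1} =
      univ.pi fun _ => Iic (g z) := by
    ext
    simp [Pi.le_def]
  simp only [hz, Measure.pi_pi, ENNReal.toReal_pow, Finset.prod_const, Finset.card_univ,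
    Fintype.card_fin, ← measureReal_def, gaussianReal_real_Iic, smul_eq_mul,
    stdPdf_eq_gaussianPDFReal_s12]

lemma hasLaw_eval_stdGaussianPi {ι : Type*} [Fintype ι] (k : ι) :
    HasLaw (fun u : ι → ℝ => u k) (gaussianReal 0 1) (stdGaussianPi ι) :=
  (measurePreserving_eval (fun _ : ι => gaussianReal 0 1) k).hasLaw

lemma iIndepFun_eval_stdGaussianPi (ι : Type*) [Fintype ι] :
    iIndepFun (fun (k : ι) (u : ι → ℝ) => u k) (stdGaussianPi ι) :=
  iIndepFun_pi (X := fun _ x => x) fun _ => aemeasurable_id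

lemma map_sub_mul_div_sqrt_stdGaussianPi {ι : Type*} [Fintype ι] {k l : ι} (hkl : k ≠ l) (a : ℝ) :
    (stdGaussianPi ι).map (fun u => (u k - a * u l) / √(1 + a ^ 2)) = gaussianReal 0 1 := by
  have hind : IndepFun (fun u : ι → ℝ => u k) (fun u => -a * u l) (stdGaussianPi ι) :=
    ((iIndepFun_eval_stdGaussianPi ι).indepFun hkl).comp measurable_id (measurable_const_mul (-a))
  have hsum := gaussianReal_add_gaussianReal_of_indepFun hind
    (hasLaw_eval_stdGaussianPi k).map_eq
    (gaussianReal_const_mul (hasLaw_eval_stdGaussianPi l) (-a)).map_eq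
  have hlaw := gaussianReal_div_const ⟨by fun_prop, hsum⟩ √(1 + a ^ 2)
  convert hlaw.map_eq using 2
  · ext u
    simp only [Pi.add_apply]
    ring
  · simp
  · ext
    have : (0 : ℝ) < 1 + a ^ 2 := by positivity
    simp [Real.sq_sqrt this.le, this.ne']

lemma memLp_eval_stdGaussianPi {ι : Type*} [Fintype ι] (k : ι) :
    MemLp (fun u : ι → ℝ => u k) 2 (stdGaussianPi ι) :=
  (memLp_id_gaussianReal' 2 (by simp)).comp_measurePreserving
    (measurePreserving_eval (fun _ : ι => gaussianReal 0 1) k)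

lemma integrable_eval_mul_eval_stdGaussianPi {ι : Type*} [Fintype ι] (k l : ι) :
    Integrable (fun u : ι → ℝ => u k * u l) (stdGaussianPi ι) :=
  (memLp_eval_stdGaussianPi k).integrable_mul (memLp_eval_stdGaussianPi l)

lemma integral_eval_mul_self_stdGaussianPi {ι : Type*} [Fintype ι] (k : ι) :
    ∫ u, u k * u k ∂stdGaussianPi ι = 1 := by
  have h : ∫ x, x * x ∂gaussianReal 0 1 = 1 := by
    have := variance_of_integral_eq_zero (X := fun x : ℝ => x) (μ := gaussianReal 0 1)
      aemeasurable_id integral_id_gaussianReal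
    rw [variance_fun_id_gaussianReal] at this
    simpa [pow_two] using this.symm
  rw [← h]
  exact integral_comp_eval (μ := fun _ : ι => gaussianReal 0 1) (f := fun x : ℝ => x * x)
    (by fun_prop)

lemma integral_eval_mul_eval_stdGaussianPi {ι : Type*} [Fintype ι] {k l : ι} (hkl : k ≠ l) :
    ∫ u, u k * u l ∂stdGaussianPi ι = 0 := by
  have h : ∫ u, u k ∂stdGaussianPi ι = 0 := by
    rw [(hasLaw_eval_stdGaussianPi k).integral_eq, integral_id_gaussianReal]
  have := ((iIndepFun_eval_stdGaussianPi ι).indepFun hkl).integral_fun_mul_eq_mul_integral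
    (measurable_pi_apply k).aestronglyMeasurable
    (measurable_pi_apply l).aestronglyMeasurable
  rw [this, h, zero_mul]

/-- Evaluation of the normalization constant `K_n(α0, α1) = ∫ φ(z) Φ(α0 + α1 z)^n dz`
of the generalized Balakrishnan-type skew-normal density: it equals the probability
that `U_i ≤ α0 + α1 U_0` for all `i = 1, …, n` for i.i.d. standard normals
`U_0, …, U_n`, equivalently that `W_i = (U_i - α1 U_0)/√(1+α1²) ≤ α0/√(1+α1²)` for all
`i`; the `W_i` are standard normal with pairwise covariance `α1²/(1+α1²)`. -/
theorem stmt12 (n : ℕ) (hn : 1 ≤ n) (α0 α1 : ℝ) :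
    ((∫ z : ℝ, stdPdf z * (stdCdf (α0 + α1 * z)) ^ n) =
      ∫ u : Fin (n + 1) → ℝ,
        Set.indicator {u : Fin (n + 1) → ℝ | ∀ i : Fin n, u i.succ ≤ α0 + α1 * u 0}
          (fun _ => (1 : ℝ)) u * ∏ i, stdPdf (u i)) ∧
    ((∫ z : ℝ, stdPdf z * (stdCdf (α0 + α1 * z)) ^ n) =
      ∫ u : Fin (n + 1) → ℝ,
        Set.indicator {u : Fin (n + 1) → ℝ | ∀ i : Fin n,
            (u i.succ - α1 * u 0) / Real.sqrt (1 + α1 ^ 2) ≤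
              α0 / Real.sqrt (1 + α1 ^ 2)}
          (fun _ => (1 : ℝ)) u * ∏ i, stdPdf (u i)) ∧
    (∀ i : Fin n, ∀ a : ℝ,
      (∫ u : Fin (n + 1) → ℝ,
        Set.indicator {u : Fin (n + 1) → ℝ |
            (u i.succ - α1 * u 0) / Real.sqrt (1 + α1 ^ 2) ≤ a}
          (fun _ => (1 : ℝ)) u * ∏ k, stdPdf (u k)) = stdCdf a) ∧
    (∀ i j : Fin n, i ≠ j →
      (∫ u : Fin (n + 1) → ℝ,
        ((u i.succ - α1 * u 0) / Real.sqrt (1 + α1 ^ 2)) *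
          ((u j.succ - α1 * u 0) / Real.sqrt (1 + α1 ^ 2)) * ∏ k, stdPdf (u k)) =
        α1 ^ 2 / (1 + α1 ^ 2)) := by
  have hpos : 0 < √(1 + α1 ^ 2) := Real.sqrt_pos.2 (by positivity)
  have hfst : (∫ z : ℝ, stdPdf z * (stdCdf (α0 + α1 * z)) ^ n) =
      ∫ u : Fin (n + 1) → ℝ,
        Set.indicator {u : Fin (n + 1) → ℝ | ∀ i : Fin n, u i.succ ≤ α0 + α1 * u 0}
          (fun _ => (1 : ℝ)) u * ∏ i, stdPdf (u i) := by
    rw [integral_indicator_mul_prod_stdPdf,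
      stdGaussianPi_real_forall_succ_le n (g := fun z => α0 + α1 * z) (by fun_prop)]
    rw [ofPred_forall]
    exact .iInter fun i => measurableSet_le (by fun_prop) (by fun_prop)
  refine ⟨hfst, ?_, fun i a => ?_, fun i j hij => ?_⟩
  · simp only [div_le_div_iff_of_pos_right hpos, sub_le_iff_le_add]
    exact hfst
  · have hW : Measurable fun u : Fin (n + 1) → ℝ => (u i.succ - α1 * u 0) / √(1 + α1 ^ 2) := by
      fun_prop
    rw [integral_indicator_mul_prod_stdPdf (measurableSet_le hW measurable_const),
      ← gaussianReal_real_Iic, ← map_sub_mul_div_sqrt_stdGaussianPi i.succ_ne_zero α1,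
      map_measureReal_apply hW measurableSet_Iic]
    rfl
  · rw [integral_mul_prod_stdPdf]
    have hexp : ∀ u : Fin (n + 1) → ℝ,
        (u i.succ - α1 * u 0) / √(1 + α1 ^ 2) * ((u j.succ - α1 * u 0) / √(1 + α1 ^ 2)) =
          (u i.succ * u j.succ - α1 * (u i.succ * u 0) - α1 * (u j.succ * u 0) +
            α1 ^ 2 * (u 0 * u 0)) / (1 + α1 ^ 2) := fun u => by
      rw [div_mul_div_comm, Real.mul_self_sqrt (by positivity)]
      ring
    have hint := integrable_eval_mul_eval_stdGaussianPi (ι := Fin (n + 1))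
    simp_rw [hexp]
    rw [integral_div, integral_add (by fun_prop) (by fun_prop),
      integral_sub (by fun_prop) (by fun_prop), integral_sub (by fun_prop) (by fun_prop)]
    simp only [integral_const_mul]
    rw [integral_eval_mul_eval_stdGaussianPi (by simpa using hij),
      integral_eval_mul_eval_stdGaussianPi i.succ_ne_zero,
      integral_eval_mul_eval_stdGaussianPi j.succ_ne_zero, integral_eval_mul_self_stdGaussianPi]
    ring

end
end
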